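/- Let Σ_A be a topologically mixing one-sided countable topological Markov shift and φ : Σ_A → ℝ a potential satisfying the Walters condition with P_G(φ) < ∞, and suppose φ is recurrent. Let h : Σ_A → (0,∞) be a positive continuous function and ν a conservative σ-finite Borel measure, finite on every cylinder, such that L_φ h = e^{P_G(φ)} h and L*_φ ν = e^{P_G(φ)} ν. Then the measure m defined by dm = h dν is a (φ + log h − log h∘σ − P_G(φ))-DLR measure. -/

import Mathlib

open MeasureTheory Filter Topology ENNReal

namespace CMS

/-- A sequence is admissible for the transition matrix `A`. -/
def IsAdm (A : ℕ → ℕ → Bool) (u : ℕ → ℕ) : Prop := ∀ i, A (u i) (u (i + 1)) = true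

/-- The one-sided countable topological Markov shift. -/
abbrev Space (A : ℕ → ℕ → Bool) := {u : ℕ → ℕ // IsAdm A u}

/-- The transition matrix has no row and no column identically zero. -/
def NoDegenerate (A : ℕ → ℕ → Bool) : Prop :=
  (∀ i, ∃ j, A i j = true) ∧ (∀ j, ∃ i, A i j = true)

/-- The shift map. -/
def shift {A : ℕ → ℕ → Bool} (x : Space A) : Space A :=
  ⟨fun i => x.1 (i + 1), fun i => x.2 (i + 1)⟩

/-- Birkhoff (ergodic) sum `φ_n`. -/
noncomputable def birkhoff {A : ℕ → ℕ → Bool} (φ : Space A → ℝ) (n : ℕ) (x : Space A) : ℝ :=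
  ∑ i ∈ Finset.range n, φ (shift^[i] x)

/-- The cylinder set determined by a word. -/
def cyl (A : ℕ → ℕ → Bool) (w : List ℕ) : Set (Space A) :=
  {x | ∀ i : Fin w.length, x.1 i = w.get i}

/-- Concatenation of a finite word with a sequence. -/
def concatSeq (w : List ℕ) (u : ℕ → ℕ) : ℕ → ℕ :=
  fun i => if h : i < w.length then w.get ⟨i, h⟩ else u (i - w.length)

/-- Prepending a single symbol to a sequence. -/
def prependSeq (a : ℕ) (u : ℕ → ℕ) : ℕ → ℕ := fun i => Nat.casesOn i a u

/-- The set of points to which the symbol `a` may be prepended. -/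
def admits (A : ℕ → ℕ → Bool) (a : ℕ) : Set (Space A) := {x | A a (x.1 0) = true}

/-- Prepending a symbol to a point of the shift space (identity if not admissible). -/
noncomputable def prep (A : ℕ → ℕ → Bool) (a : ℕ) (x : Space A) : Space A :=
  if h : A a (x.1 0) = true then
    ⟨prependSeq a x.1, by
      intro i
      cases i with
      | zero => exact h
      | succ j => exact x.2 j⟩
  else x

/-- The measure `ν ⊚ σ`, `ν⊚σ(E) = Σ_a ν(σ(E ∩ [a]))`. -/
noncomputable def circ (A : ℕ → ℕ → Bool) (ν : Measure (Space A)) : Measure (Space A) :=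
  Measure.sum fun a : ℕ => (ν.restrict (admits A a)).map (prep A a)

/-- `ν` is `(φ, l)`-conformal: `dν/d(ν⊚σ) = l⁻¹ e^φ`. -/
def Conformal (A : ℕ → ℕ → Bool) (φ : Space A → ℝ) (l : ℝ) (ν : Measure (Space A)) : Prop :=
  ∀ E : Set (Space A), MeasurableSet E →
    ν E = ∫⁻ x in E, ENNReal.ofReal (l⁻¹ * Real.exp (φ x)) ∂(circ A ν)

/-- The Ruelle transfer operator. -/
noncomputable def ruelle (A : ℕ → ℕ → Bool) (φ f : Space A → ℝ) (x : Space A) : ℝ :=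
  ∑' a : ℕ, if A a (x.1 0) = true then Real.exp (φ (prep A a x)) * f (prep A a x) else 0

/-- The Ruelle operator applied to the constant function 1, valued in `ℝ≥0∞`. -/
noncomputable def ruelleOne (A : ℕ → ℕ → Bool) (φ : Space A → ℝ) (x : Space A) : ℝ≥0∞ :=
  ∑' a : ℕ, if A a (x.1 0) = true then ENNReal.ofReal (Real.exp (φ (prep A a x))) else 0

/-- `L*_φ ν = l ν` : the dual eigenmeasure equation. -/
def DualEigen (A : ℕ → ℕ → Bool) (φ : Space A → ℝ) (l : ℝ) (ν : Measure (Space A)) : Prop :=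
  ∀ f : Space A → ℝ, Integrable f ν →
    ∫ x, ruelle A φ f x ∂ν = l * ∫ x, f x ∂ν

/-- The sub-σ-algebra `σ^{-n} 𝓑`. -/
def shiftSigma (A : ℕ → ℕ → Bool) (n : ℕ) : MeasurableSpace (Space A) :=
  MeasurableSpace.comap (shift^[n]) inferInstance

/-- A sub-σ-algebra `m` is compatible with `ν`: the restriction of `ν` to `m` is σ-finite. -/
def Compatible (A : ℕ → ℕ → Bool) (ν : Measure (Space A))
    (m : MeasurableSpace (Space A)) : Prop :=
  ∃ s : ℕ → Set (Space A), (∀ k, MeasurableSet[m] (s k)) ∧ (∀ k, ν (s k) ≠ ⊤) ∧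
    (⋃ k, s k) = Set.univ

open Classical in
/-- Numerator of the DLR kernel: `e^{φ_n(w σ^n x)} 1{w σ^n x ∈ Σ_A}`. -/
noncomputable def dlrNum (A : ℕ → ℕ → Bool) (φ : Space A → ℝ) (w : List ℕ)
    (x : Space A) : ℝ :=
  if h : IsAdm A (concatSeq w ((shift^[w.length] x).1)) then
    Real.exp (birkhoff φ w.length (⟨concatSeq w ((shift^[w.length] x).1), h⟩ : Space A))
  else 0

/-- Denominator of the DLR kernel: `Σ_{y : σ^n y = σ^n x} e^{φ_n(y)}`. -/
noncomputable def dlrDen (A : ℕ → ℕ → Bool) (φ : Space A → ℝ) (n : ℕ) (x : Space A) : ℝ :=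
  ∑' y : {y : Space A // shift^[n] y = shift^[n] x}, Real.exp (birkhoff φ n y.1)

/-- `ν` is a `φ`-DLR measure. -/
def IsDLR (A : ℕ → ℕ → Bool) (φ : Space A → ℝ) (ν : Measure (Space A)) : Prop :=
  ∀ n : ℕ, 1 ≤ n →
    Compatible A ν (shiftSigma A n) ∧
    ∀ w : List ℕ, w.length = n →
      (ν[Set.indicator (cyl A w) (fun _ => (1 : ℝ))|shiftSigma A n])
        =ᵐ[ν] fun x => dlrNum A φ w x / dlrDen A φ n x

/-- `ν` is non-singular: `ν ∘ σ⁻¹ ∼ ν`. -/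
def NonSingular (A : ℕ → ℕ → Bool) (ν : Measure (Space A)) : Prop :=
  ν.map shift ≪ ν ∧ ν ≪ ν.map shift

/-- Conservative non-singular measure. -/
def Conservative (A : ℕ → ℕ → Bool) (ν : Measure (Space A)) : Prop :=
  NonSingular A ν ∧
    ∀ W : Set (Space A), MeasurableSet W →
      (∀ i j : ℕ, i ≠ j → ν ((shift^[i] ⁻¹' W) ∩ (shift^[j] ⁻¹' W)) = 0) → ν W = 0

/-- The `n`-th variation `Var_n φ`, valued in `ℝ≥0∞`. -/
noncomputable def varn (A : ℕ → ℕ → Bool) (φ : Space A → ℝ) (n : ℕ) : ℝ≥0∞ :=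
  ⨆ (x : Space A) (y : Space A) (_ : ∀ i, i < n → x.1 i = y.1 i),
    ENNReal.ofReal |φ x - φ y|

noncomputable def waltersBound (A : ℕ → ℕ → Bool) (φ : Space A → ℝ) (k : ℕ) : ℝ≥0∞ :=
  ⨆ (n : ℕ) (_ : 1 ≤ n), varn A (birkhoff φ n) (n + k)

/-- The Walters condition. -/
def Walters (A : ℕ → ℕ → Bool) (φ : Space A → ℝ) : Prop :=
  (∀ k, 1 ≤ k → waltersBound A φ k ≠ ⊤) ∧
  Tendsto (waltersBound A φ) atTop (nhds 0)

/-- `φ` is weakly Hölder continuous. -/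
def WeaklyHolder (A : ℕ → ℕ → Bool) (φ : Space A → ℝ) : Prop :=
  ∃ H θ : ℝ, 0 < H ∧ θ ∈ Set.Ioo (0 : ℝ) 1 ∧
    ∀ n : ℕ, 2 ≤ n → varn A φ n ≤ ENNReal.ofReal (H * θ ^ n)

/-- The partition function `Z_n(φ, a)`, valued in `ℝ≥0∞`. -/
noncomputable def Zn (A : ℕ → ℕ → Bool) (φ : Space A → ℝ) (n a : ℕ) : ℝ≥0∞ :=
  ∑' x : {x : Space A // shift^[n] x = x ∧ x.1 0 = a},
    ENNReal.ofReal (Real.exp (birkhoff φ n x.1))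

/-- The partition function `Z*_n(φ, a)` over periodic points whose first return to `[a]` is `n`. -/
noncomputable def Znstar (A : ℕ → ℕ → Bool) (φ : Space A → ℝ) (n a : ℕ) : ℝ≥0∞ :=
  ∑' x : {x : Space A // shift^[n] x = x ∧ x.1 0 = a ∧
      ∀ k, 0 < k → k < n → (shift^[k] x).1 0 ≠ a},
    ENNReal.ofReal (Real.exp (birkhoff φ n x.1))

/-- `P` is the (finite) Gurevich pressure of `φ`. -/
def HasGurevich (A : ℕ → ℕ → Bool) (φ : Space A → ℝ) (P : ℝ) : Prop :=
  ∀ a : ℕ, (cyl A [a]).Nonempty →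
    (∀ n, 1 ≤ n → Zn A φ n a ≠ ⊤) ∧
    Tendsto (fun n : ℕ => Real.log (Zn A φ n a).toReal / n) atTop (nhds P)

/-- `φ` is recurrent (with Gurevich pressure `P`). -/
def Recurrent (A : ℕ → ℕ → Bool) (φ : Space A → ℝ) (P : ℝ) : Prop :=
  ∀ a : ℕ, (cyl A [a]).Nonempty →
    ∑' n : ℕ, ENNReal.ofReal (Real.exp (-((n + 1 : ℕ) : ℝ) * P)) * Zn A φ (n + 1) a = ⊤

/-- `φ` is positive recurrent (with Gurevich pressure `P`). -/
def PosRecurrent (A : ℕ → ℕ → Bool) (φ : Space A → ℝ) (P : ℝ) : Prop :=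
  Recurrent A φ P ∧
  ∀ a : ℕ, (cyl A [a]).Nonempty →
    ∑' n : ℕ, ((n + 1 : ℕ) : ℝ≥0∞) *
      ENNReal.ofReal (Real.exp (-((n + 1 : ℕ) : ℝ) * P)) * Znstar A φ (n + 1) a ≠ ⊤

/-- `φ` is transient (with Gurevich pressure `P`). -/
def Transient (A : ℕ → ℕ → Bool) (φ : Space A → ℝ) (P : ℝ) : Prop :=
  ∀ a : ℕ, (cyl A [a]).Nonempty →
    ∑' n : ℕ, ENNReal.ofReal (Real.exp (-((n + 1 : ℕ) : ℝ) * P)) * Zn A φ (n + 1) a ≠ ⊤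

/-- `Σ_A` is topologically mixing. -/
def TopMixing (A : ℕ → ℕ → Bool) : Prop :=
  ∀ a b : ℕ, ∃ N : ℕ, ∀ n, N < n → ∃ x : Space A, x.1 0 = a ∧ (shift^[n] x).1 0 = b

/-- The big images and preimages (BIP) property. -/
def BIP (A : ℕ → ℕ → Bool) : Prop :=
  ∃ (N : ℕ) (b : Fin N → ℕ), ∀ a : ℕ,
    (∃ i, A (b i) a = true) ∧ (∃ j, A a (b j) = true)

/-- An admissible word. -/
def AdmWord (A : ℕ → ℕ → Bool) (w : List ℕ) : Prop :=
  ∀ (i : ℕ) (h : i + 1 < w.length),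
    A (w.get ⟨i, Nat.lt_of_succ_lt h⟩) (w.get ⟨i + 1, h⟩) = true

/-- The image of `E ⊆ [a̲]` under the cylinder-swapping map `v_{a̲,b̲}`. -/
def swapImage (A : ℕ → ℕ → Bool) (b : List ℕ) (E : Set (Space A)) : Set (Space A) :=
  {y | ∃ x ∈ E, y.1 = concatSeq b ((shift^[b.length] x).1)}

/-- The image of `E` under the prepending map `I_b`. -/
def prepImage (A : ℕ → ℕ → Bool) (b : ℕ) (E : Set (Space A)) : Set (Space A) :=
  {y | ∃ x ∈ E, y.1 = prependSeq b x.1}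

/-- The transition matrix of the renewal shift:
`A(1,1) = A(1,i) = A(i,i-1) = 1` (for `i > 1`), all other entries `0`. -/
def renA : ℕ → ℕ → Bool := fun i j => decide ((i = 1 ∧ 1 ≤ j) ∨ (2 ≤ i ∧ j = i - 1))

/-- The transition matrix of the shift `Σ_{𝓡⁻}`:
`A(i,i+1) = A(i,1) = 1` for `i ≥ 1`, all other entries `0`. -/
def rminusA : ℕ → ℕ → Bool := fun i j => decide (1 ≤ i ∧ (j = i + 1 ∨ j = 1))

/-- The periodic sequence obtained by repeating the word `w`. -/
def perSeq (w : List ℕ) : ℕ → ℕ := fun i => w.getD (i % w.length) 0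

/-- The word `(j, j-1, …, 1, n, n-1, …, j+1)`. -/
def gammaWord (j n : ℕ) : List ℕ :=
  ((List.range j).map (· + 1)).reverse ++ ((List.range (n - j)).map (· + (j + 1))).reverse

/-- The point `x̄ = (1, 2, 3, …)` of `Σ_{𝓡⁻}`. -/
def xbar : Space rminusA := ⟨fun i => i + 1, by intro i; simp [rminusA]⟩

section Fiber

variable {A : ℕ → ℕ → Bool}

theorem shift_iterate_apply (n : ℕ) (x : Space A) (i : ℕ) :
    (shift^[n] x).1 i = x.1 (n + i) := by
  induction n generalizing x with
  | zero => simp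
  | succ n ih =>
    rw [Function.iterate_succ_apply, ih]
    change x.1 (n + i + 1) = _
    exact congrArg x.1 (by omega)

theorem measurable_coord (i : ℕ) : Measurable fun x : Space A => x.1 i :=
  (measurable_pi_apply i).comp measurable_subtype_coe

theorem measurable_shift : Measurable (shift : Space A → Space A) :=
  Measurable.subtype_mk (measurable_pi_lambda _ fun i => measurable_coord (i + 1))

theorem measurableSet_admits (a : ℕ) : MeasurableSet (admits A a) :=
  (measurable_coord 0) (MeasurableSet.of_discrete (s := {b | A a b = true}))

theorem prep_val {a : ℕ} {x : Space A} (hx : A a (x.1 0) = true) :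
    (prep A a x).1 = prependSeq a x.1 := by
  simp [prep, hx]

theorem shift_prep {a : ℕ} {x : Space A} (hx : A a (x.1 0) = true) :
    shift (prep A a x) = x := by
  apply Subtype.ext
  funext i
  change (prep A a x).1 (i + 1) = x.1 i
  rw [prep_val hx]
  rfl

theorem prep_zero {a : ℕ} {x : Space A} (hx : A a (x.1 0) = true) :
    (prep A a x).1 0 = a := by
  rw [prep_val hx]
  rfl

theorem prep_shift (y : Space A) : prep A (y.1 0) (shift y) = y := by
  have hy : A (y.1 0) ((shift y).1 0) = true := y.2 0
  apply Subtype.ext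
  rw [prep_val hy]
  funext i
  cases i <;> rfl

theorem measurable_prep (a : ℕ) : Measurable (prep A a) := by
  have hval : Measurable fun x : Space A => (prep A a x).1 := by
    refine measurable_pi_lambda _ fun i => ?_
    have heq : (fun x : Space A => (prep A a x).1 i) = fun x =>
        @ite ℕ (x ∈ admits A a) (Classical.propDecidable _) (prependSeq a x.1 i) (x.1 i) := by
      funext x
      by_cases hx : A a (x.1 0) = true
      · rw [if_pos (show x ∈ admits A a from hx), prep_val hx]
      · rw [if_neg (show x ∉ admits A a from hx)]
        simp [prep, hx]
    rw [heq]
    refine Measurable.ite (measurableSet_admits a) ?_ (measurable_coord i)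
    cases i with
    | zero => exact measurable_const
    | succ j => exact measurable_coord j
  exact hval.subtype_mk

theorem birkhoff_add (φ : Space A → ℝ) (n k : ℕ) (x : Space A) :
    birkhoff φ (n + k) x = birkhoff φ n x + birkhoff φ k (shift^[n] x) := by
  simp only [birkhoff, Finset.sum_range_add]
  congr 1
  refine Finset.sum_congr rfl fun i _ => ?_
  rw [← Function.iterate_add_apply, add_comm]

open Classical in
/-- The normalised `n`-step transfer operator `e^{-nP} L_φ^n` on `ℝ≥0∞`-valued functions,
as a sum over the fiber of `σ^n`. -/
noncomputable def fiberOp (φ : Space A → ℝ) (P : ℝ) (n : ℕ) (F : Space A → ℝ≥0∞)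
    (x : Space A) : ℝ≥0∞ :=
  ∑' y : Space A, if shift^[n] y = x then
    ENNReal.ofReal (Real.exp (birkhoff φ n y - n * P)) * F y else 0

variable (φ : Space A → ℝ) (P : ℝ)

theorem fiberOp_mono (n : ℕ) {F G : Space A → ℝ≥0∞} (hFG : F ≤ G) :
    fiberOp φ P n F ≤ fiberOp φ P n G := by
  intro x
  refine ENNReal.tsum_le_tsum fun y => ?_
  split_ifs
  · gcongr
    exact hFG y
  · exact le_rfl

theorem fiberOp_add (n k : ℕ) (F : Space A → ℝ≥0∞) :
    fiberOp φ P (n + k) F = fiberOp φ P k (fiberOp φ P n F) := by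
  classical
  funext x
  have hswap : fiberOp φ P k (fiberOp φ P n F) x = ∑' z : Space A, ∑' y : Space A,
      if shift^[k] z = x ∧ shift^[n] y = z then
        ENNReal.ofReal (Real.exp (birkhoff φ k z - k * P)) *
          (ENNReal.ofReal (Real.exp (birkhoff φ n y - n * P)) * F y) else 0 := by
    refine tsum_congr fun z => ?_
    by_cases hz : shift^[k] z = x
    · rw [if_pos hz]
      simp only [hz, true_and, fiberOp]
      rw [← ENNReal.tsum_mul_left]
      refine tsum_congr fun y => ?_
      split_ifs <;> simp
    · simp [hz]
  rw [hswap, ENNReal.tsum_comm]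
  refine tsum_congr fun y => ?_
  rw [tsum_eq_single (shift^[n] y) (fun z hz => if_neg fun hc => hz hc.2.symm)]
  have hit : shift^[k] (shift^[n] y) = shift^[n + k] y := by
    rw [← Function.iterate_add_apply, add_comm]
  simp only [and_true, hit]
  split_ifs
  · rw [← mul_assoc, ← ENNReal.ofReal_mul (Real.exp_pos _).le, ← Real.exp_add, birkhoff_add]
    congr 3
    push_cast
    ring
  · rfl

theorem fiberOp_zero (F : Space A → ℝ≥0∞) : fiberOp φ P 0 F = F := by
  funext x
  rw [fiberOp, tsum_eq_single x]
  · simp [birkhoff]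
  · intro y hy
    simp [hy]

theorem fiberOp_one_eq (F : Space A → ℝ≥0∞) (x : Space A) :
    fiberOp φ P 1 F x = ∑' a : ℕ, (admits A a).indicator
      (fun x => ENNReal.ofReal (Real.exp (φ (prep A a x) - P)) * F (prep A a x)) x := by
  classical
  have hsplit : fiberOp φ P 1 F x = ∑' y : Space A, ∑' a : ℕ,
      if y.1 0 = a ∧ shift y = x then ENNReal.ofReal (Real.exp (φ y - P)) * F y else 0 := by
    refine tsum_congr fun y => ?_
    rw [tsum_eq_single (y.1 0) (fun a ha => if_neg fun hc => ha hc.1.symm)]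
    simp [birkhoff]
  rw [hsplit, ENNReal.tsum_comm]
  refine tsum_congr fun a => ?_
  by_cases hx : A a (x.1 0) = true
  · rw [Set.indicator_of_mem (show x ∈ admits A a from hx), tsum_eq_single (prep A a x)]
    · rw [if_pos ⟨prep_zero hx, shift_prep hx⟩]
    · rintro y hy
      refine if_neg ?_
      rintro ⟨rfl, rfl⟩
      exact hy (prep_shift y).symm
  · rw [Set.indicator_of_notMem (show x ∉ admits A a from hx)]
    refine ENNReal.tsum_eq_zero.2 fun y => if_neg ?_
    rintro ⟨rfl, rfl⟩
    exact hx (y.2 0)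

theorem fiberOp_comp_mul (n : ℕ) (F G : Space A → ℝ≥0∞) :
    fiberOp φ P n (fun y => F (shift^[n] y) * G y) = fun x => F x * fiberOp φ P n G x := by
  funext x
  simp only [fiberOp]
  rw [← ENNReal.tsum_mul_left]
  refine tsum_congr fun y => ?_
  split_ifs with hy
  · rw [hy]
    ring
  · simp

theorem fiberOp_finset_sum {ι : Type*} (s : Finset ι) (n : ℕ) (F : ι → Space A → ℝ≥0∞)
    (x : Space A) :
    fiberOp φ P n (fun y => ∑ i ∈ s, F i y) x = ∑ i ∈ s, fiberOp φ P n (F i) x := by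
  simp only [fiberOp]
  rw [← Summable.tsum_finsetSum fun i _ => ENNReal.summable]
  refine tsum_congr fun y => ?_
  split_ifs
  · rw [Finset.mul_sum]
  · simp

variable {φ}

theorem measurable_fiberOp (hφ : Measurable φ) (n : ℕ) {F : Space A → ℝ≥0∞}
    (hF : Measurable F) : Measurable (fiberOp φ P n F) := by
  induction n with
  | zero => rwa [fiberOp_zero]
  | succ n ih =>
    rw [fiberOp_add]
    have heq := funext (fiberOp_one_eq φ P (fiberOp φ P n F))
    rw [heq]
    refine Measurable.tsum fun a => Measurable.indicator ?_ (measurableSet_admits a)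
    exact (((hφ.comp (measurable_prep a)).sub_const P).exp.ennreal_ofReal).mul
      (ih.comp (measurable_prep a))

theorem lintegral_circ_withDensity (hφ : Measurable φ) (ν : Measure (Space A))
    {F : Space A → ℝ≥0∞} (hF : Measurable F) :
    ∫⁻ x, F x ∂((circ A ν).withDensity fun y => ENNReal.ofReal (Real.exp (φ y - P))) =
      ∫⁻ x, fiberOp φ P 1 F x ∂ν := by
  have hd : Measurable fun y : Space A => ENNReal.ofReal (Real.exp (φ y - P)) :=
    (hφ.sub_const P).exp.ennreal_ofReal
  rw [lintegral_withDensity_eq_lintegral_mul _ hd hF, circ, lintegral_sum_measure]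
  simp_rw [fiberOp_one_eq]
  rw [lintegral_tsum]
  · refine tsum_congr fun a => ?_
    rw [lintegral_map (hd.mul hF) (measurable_prep a), lintegral_indicator (measurableSet_admits a)]
    rfl
  · intro a
    exact (((hd.mul hF).comp (measurable_prep a)).indicator (measurableSet_admits a)).aemeasurable

theorem ruelle_eq_toReal {f : Space A → ℝ} (hf : ∀ x, 0 ≤ f x) (x : Space A) :
    ruelle A φ f x =
      Real.exp P * (fiberOp φ P 1 (fun y => ENNReal.ofReal (f y)) x).toReal := by
  rw [fiberOp_one_eq, ENNReal.tsum_toReal_eq, ← tsum_mul_left]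
  · refine tsum_congr fun a => ?_
    by_cases hx : A a (x.1 0) = true
    · rw [if_pos hx, Set.indicator_of_mem (show x ∈ admits A a from hx), ENNReal.toReal_mul,
        ENNReal.toReal_ofReal (Real.exp_pos _).le, ENNReal.toReal_ofReal (hf _), ← mul_assoc,
        ← Real.exp_add]
      congr 2
      ring
    · rw [if_neg hx, Set.indicator_of_notMem (show x ∉ admits A a from hx)]
      simp
  · intro a
    by_cases hx : x ∈ admits A a
    · rw [Set.indicator_of_mem hx]
      exact ENNReal.mul_ne_top ENNReal.ofReal_ne_top ENNReal.ofReal_ne_top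
    · rw [Set.indicator_of_notMem hx]
      simp

variable {P} {h : Space A → ℝ}

theorem fiberOp_one_eigenfunction (hpos : ∀ x, 0 < h x)
    (heigf : ∀ x, ruelle A φ h x = Real.exp P * h x) :
    fiberOp φ P 1 (fun y => ENNReal.ofReal (h y)) = fun y => ENNReal.ofReal (h y) := by
  funext x
  have hx := heigf x
  rw [ruelle_eq_toReal P (fun y => (hpos y).le)] at hx
  have hx' := mul_left_cancel₀ (Real.exp_pos P).ne' hx
  rw [← hx', ENNReal.ofReal_toReal]
  intro htop
  rw [htop] at hx'
  exact (hpos x).ne hx'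

theorem fiberOp_eigenfunction (hpos : ∀ x, 0 < h x)
    (heigf : ∀ x, ruelle A φ h x = Real.exp P * h x) (n : ℕ) :
    fiberOp φ P n (fun y => ENNReal.ofReal (h y)) = fun y => ENNReal.ofReal (h y) := by
  induction n with
  | zero => rw [fiberOp_zero]
  | succ n ih => rw [fiberOp_add, ih, fiberOp_one_eigenfunction hpos heigf]

variable {ν : Measure (Space A)}

theorem toReal_lintegral_fiberOp_indicator (hφ : Measurable φ) (hm : Measurable h)
    (hpos : ∀ x, 0 < h x) (heigf : ∀ x, ruelle A φ h x = Real.exp P * h x)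
    (heigm : DualEigen A φ (Real.exp P) ν) {E : Set (Space A)} (hE : MeasurableSet E)
    (hfin : ∫⁻ x in E, ENNReal.ofReal (h x) ∂ν ≠ ⊤) :
    (∫⁻ x, fiberOp φ P 1 (E.indicator fun y => ENNReal.ofReal (h y)) x ∂ν).toReal =
      (∫⁻ x in E, ENNReal.ofReal (h x) ∂ν).toReal := by
  have hint : Integrable (E.indicator h) ν := by
    rw [integrable_indicator_iff hE]
    exact (lintegral_ofReal_ne_top_iff_integrable hm.aestronglyMeasurable
      (Eventually.of_forall fun x => (hpos x).le)).1 hfin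
  have hnn : ∀ x, 0 ≤ E.indicator h x := fun x =>
    Set.indicator_nonneg (fun y _ => (hpos y).le) x
  have hof : (fun y => ENNReal.ofReal (E.indicator h y)) =
      E.indicator fun y => ENNReal.ofReal (h y) := by
    funext y
    by_cases hy : y ∈ E <;> simp [hy]
  have hdual := heigm _ hint
  simp_rw [ruelle_eq_toReal P hnn, hof] at hdual
  rw [integral_const_mul] at hdual
  have hdual' := mul_left_cancel₀ (Real.exp_pos P).ne' hdual
  have hmE : Measurable (E.indicator fun y => ENNReal.ofReal (h y)) :=
    hm.ennreal_ofReal.indicator hE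
  rw [integral_toReal (measurable_fiberOp P hφ 1 hmE).aemeasurable] at hdual'
  · rw [hdual', integral_indicator hE, integral_eq_lintegral_of_nonneg_ae
      (Eventually.of_forall fun x => (hpos x).le) hm.aestronglyMeasurable]
  · refine Eventually.of_forall fun x => ?_
    refine (fiberOp_mono φ P 1 (Set.indicator_le_self _ _) x).trans_lt ?_
    rw [fiberOp_one_eigenfunction hpos heigf]
    exact ENNReal.ofReal_lt_top

theorem circ_withDensity_eq [SigmaFinite ν] (hφ : Measurable φ) (hm : Measurable h)
    (hpos : ∀ x, 0 < h x) (heigf : ∀ x, ruelle A φ h x = Real.exp P * h x)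
    (heigm : DualEigen A φ (Real.exp P) ν) :
    (circ A ν).withDensity (fun y => ENNReal.ofReal (Real.exp (φ y - P))) = ν := by
  set H : Space A → ℝ≥0∞ := fun y => ENNReal.ofReal (h y) with hH
  have hHm : Measurable H := hm.ennreal_ofReal
  set μ := (circ A ν).withDensity (fun y => ENNReal.ofReal (Real.exp (φ y - P))) with hμ
  have : SigmaFinite (ν.withDensity H) := SigmaFinite.withDensity_ofReal _
  have hval : ∀ {E}, MeasurableSet E → μ.withDensity H E =
      ∫⁻ x, fiberOp φ P 1 (E.indicator H) x ∂ν := by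
    intro E hE
    rw [withDensity_apply _ hE, ← lintegral_indicator hE, hμ,
      lintegral_circ_withDensity P hφ ν (hHm.indicator hE)]
  have htoReal : ∀ {E}, MeasurableSet E → ν.withDensity H E ≠ ⊤ →
      (μ.withDensity H E).toReal = (ν.withDensity H E).toReal := by
    intro E hE hfin
    rw [withDensity_apply _ hE] at hfin
    rw [hval hE, withDensity_apply _ hE]
    exact toReal_lintegral_fiberOp_indicator hφ hm hpos heigf heigm hE hfin
  have hposE : ∀ {E}, MeasurableSet E → ν.withDensity H E ≠ ⊤ → ν.withDensity H E ≠ 0 →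
      μ.withDensity H E ≠ ⊤ := by
    intro E hE hfin h0 htop
    have hc := htoReal hE hfin
    rw [htop, ENNReal.toReal_top] at hc
    exact (ENNReal.toReal_pos h0 hfin).ne hc
  have hne : ∀ {E}, MeasurableSet E → ν.withDensity H E ≠ ⊤ → μ.withDensity H E ≠ ⊤ := by
    intro E hE hfin
    by_cases h0 : ν.withDensity H Set.univ = 0
    · have hν : ν = 0 := by
        rw [withDensity_apply _ MeasurableSet.univ, Measure.restrict_univ,
          lintegral_eq_zero_iff hHm] at h0
        rw [← ae_eq_bot, ← Filter.eventually_false_iff_eq_bot]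
        filter_upwards [h0] with x hx
        exact (ENNReal.ofReal_pos.2 (hpos x)).ne' hx
      rw [hval hE, hν]
      simp
    · obtain ⟨k, hk⟩ : ∃ k, ν.withDensity H (spanningSets (ν.withDensity H) k) ≠ 0 := by
        by_contra! hall
        apply h0
        rw [← iUnion_spanningSets (ν.withDensity H)]
        exact measure_iUnion_null hall
      have hun := hE.union (measurableSet_spanningSets (ν.withDensity H) k)
      refine ne_top_of_le_ne_top (hposE hun ?_ ?_) (measure_mono Set.subset_union_left)
      · exact (measure_union_lt_top hfin.lt_top (measure_spanningSets_lt_top _ k)).ne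
      · exact fun hc => hk (measure_mono_null Set.subset_union_right hc)
  have heq : μ.withDensity H = ν.withDensity H := by
    rw [Measure.ext_iff_of_iUnion_eq_univ (iUnion_spanningSets (ν.withDensity H))]
    intro k
    ext E hE
    rw [Measure.restrict_apply hE, Measure.restrict_apply hE]
    have hEk := hE.inter (measurableSet_spanningSets (ν.withDensity H) k)
    have hfin : ν.withDensity H (E ∩ spanningSets (ν.withDensity H) k) ≠ ⊤ :=
      ne_top_of_le_ne_top (measure_spanningSets_lt_top (ν.withDensity H) k).ne
        (measure_mono Set.inter_subset_right)
    exact (ENNReal.toReal_eq_toReal_iff' (hne hEk hfin) hfin).1 (htoReal hEk hfin)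
  have hinv : ∀ ρ : Measure (Space A), (ρ.withDensity H).withDensity H⁻¹ = ρ := fun ρ =>
    withDensity_inv_same hHm
      (Eventually.of_forall fun x => (ENNReal.ofReal_pos.2 (hpos x)).ne')
      (Eventually.of_forall fun x => ENNReal.ofReal_ne_top)
  rw [← hinv μ, heq, hinv]

theorem lintegral_fiberOp [SigmaFinite ν] (hφ : Measurable φ) (hm : Measurable h)
    (hpos : ∀ x, 0 < h x) (heigf : ∀ x, ruelle A φ h x = Real.exp P * h x)
    (heigm : DualEigen A φ (Real.exp P) ν) (n : ℕ) {F : Space A → ℝ≥0∞} (hF : Measurable F) :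
    ∫⁻ x, fiberOp φ P n F x ∂ν = ∫⁻ x, F x ∂ν := by
  induction n with
  | zero => rw [fiberOp_zero]
  | succ n ih =>
    rw [fiberOp_add, ← lintegral_circ_withDensity P hφ ν (measurable_fiberOp P hφ n hF),
      circ_withDensity_eq hφ hm hpos heigf heigm, ih]

theorem lintegral_comp_shift_iterate [SigmaFinite ν] (hφ : Measurable φ) (hm : Measurable h)
    (hpos : ∀ x, 0 < h x) (heigf : ∀ x, ruelle A φ h x = Real.exp P * h x)
    (heigm : DualEigen A φ (Real.exp P) ν) (n : ℕ) {F : Space A → ℝ≥0∞} (hF : Measurable F) :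
    ∫⁻ x, F (shift^[n] x) ∂(ν.withDensity fun y => ENNReal.ofReal (h y)) =
      ∫⁻ x, F x ∂(ν.withDensity fun y => ENNReal.ofReal (h y)) := by
  have hHm : Measurable fun y => ENNReal.ofReal (h y) := hm.ennreal_ofReal
  have hFn : Measurable fun x : Space A => F (shift^[n] x) := hF.comp (measurable_shift.iterate n)
  rw [lintegral_withDensity_eq_lintegral_mul _ hHm hFn,
    lintegral_withDensity_eq_lintegral_mul _ hHm hF,
    ← lintegral_fiberOp hφ hm hpos heigf heigm n (hHm.mul hFn)]
  have hcomm : ((fun y => ENNReal.ofReal (h y)) * fun x => F (shift^[n] x)) =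
      fun y => F (shift^[n] y) * ENNReal.ofReal (h y) := by
    funext y
    exact mul_comm _ _
  rw [hcomm, fiberOp_comp_mul, fiberOp_eigenfunction hpos heigf]
  exact lintegral_congr fun x => mul_comm _ _

theorem fiberOp_eq_tsum_subtype (φ : Space A → ℝ) (P : ℝ) (n : ℕ) (F : Space A → ℝ≥0∞)
    (x : Space A) :
    fiberOp φ P n F x = ∑' y : {y : Space A // shift^[n] y = x},
      ENNReal.ofReal (Real.exp (birkhoff φ n y.1 - n * P)) * F y.1 := by
  classical
  have hs := tsum_subtype {y : Space A | shift^[n] y = x}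
    fun y => ENNReal.ofReal (Real.exp (birkhoff φ n y - n * P)) * F y
  refine Eq.trans (tsum_congr fun y => ?_) hs.symm
  by_cases hy : shift^[n] y = x <;> simp [hy]

theorem birkhoff_le_of_walters (hw : Walters A φ) (n : ℕ) {y z : Space A}
    (hyz : ∀ i, i < n + 1 → y.1 i = z.1 i) :
    birkhoff φ n y ≤ birkhoff φ n z + (waltersBound A φ 1).toReal := by
  rcases Nat.eq_zero_or_pos n with rfl | hn
  · simp [birkhoff]
  · have hle : ENNReal.ofReal |birkhoff φ n y - birkhoff φ n z| ≤ waltersBound A φ 1 := by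
      refine le_trans ?_ (le_iSup₂ (f := fun n (_ : 1 ≤ n) => varn A (birkhoff φ n) (n + 1)) n hn)
      refine le_trans ?_ (le_iSup _ y)
      refine le_trans ?_ (le_iSup _ z)
      exact le_iSup (fun _ : ∀ i, i < n + 1 → y.1 i = z.1 i =>
        ENNReal.ofReal |birkhoff φ n y - birkhoff φ n z|) hyz
    have habs := (ENNReal.ofReal_le_iff_le_toReal (hw.1 1 le_rfl)).1 hle
    linarith [le_abs_self (birkhoff φ n y - birkhoff φ n z)]

/-- Replace the tail `σ^n y` of `y` by a point with the same first symbol. -/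
def graft (n : ℕ) (y x : Space A) (hyx : y.1 n = x.1 0) : Space A :=
  ⟨fun i => if i < n then y.1 i else x.1 (i - n), by
    intro i
    beta_reduce
    rcases lt_trichotomy (i + 1) n with hi | hi | hi
    · rw [if_pos (by omega), if_pos hi]
      exact y.2 i
    · rw [if_pos (by omega), if_neg (by omega), hi, Nat.sub_self, ← hyx, ← hi]
      exact y.2 i
    · rw [if_neg (by omega), if_neg (by omega), show i + 1 - n = i - n + 1 by omega]
      exact x.2 (i - n)⟩

theorem graft_apply {n : ℕ} {y x : Space A} (hyx : y.1 n = x.1 0) {i : ℕ} (hi : i < n + 1) :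
    (graft n y x hyx).1 i = y.1 i := by
  change (if i < n then y.1 i else x.1 (i - n)) = y.1 i
  split_ifs with h
  · rfl
  · obtain rfl : i = n := by omega
    rw [Nat.sub_self, hyx]

theorem shift_graft {n : ℕ} {y x : Space A} (hyx : y.1 n = x.1 0) :
    shift^[n] (graft n y x hyx) = x := by
  apply Subtype.ext
  funext i
  rw [shift_iterate_apply]
  change (if n + i < n then y.1 (n + i) else x.1 (n + i - n)) = x.1 i
  rw [if_neg (by omega), Nat.add_sub_cancel_left]

theorem fiberOp_le_of_same_start (hw : Walters A φ) (n : ℕ) {G : Space A → ℝ≥0∞}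
    (hG : ∀ y z : Space A, (∀ i, i < n + 1 → y.1 i = z.1 i) → G y = G z)
    {x x' : Space A} (hx : x'.1 0 = x.1 0) :
    fiberOp φ P n G x' ≤
      ENNReal.ofReal (Real.exp (waltersBound A φ 1).toReal) * fiberOp φ P n G x := by
  rw [fiberOp_eq_tsum_subtype, fiberOp_eq_tsum_subtype, ← ENNReal.tsum_mul_left]
  have hstart : ∀ y : {y : Space A // shift^[n] y = x'}, y.1.1 n = x.1 0 := by
    intro y
    rw [← hx]
    conv_rhs => rw [← y.2, shift_iterate_apply, Nat.add_zero]
  let e : {y : Space A // shift^[n] y = x'} → {y : Space A // shift^[n] y = x} :=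
    fun y => ⟨graft n y.1 x (hstart y), shift_graft (hstart y)⟩
  have he : Function.Injective e := by
    intro y z hyz
    have hg : graft n y.1 x (hstart y) = graft n z.1 x (hstart z) := congrArg Subtype.val hyz
    apply Subtype.ext
    apply Subtype.ext
    funext i
    rcases lt_or_ge i n with hi | hi
    · rw [← graft_apply (hstart y) (by omega : i < n + 1), hg, graft_apply _ (by omega)]
    · obtain ⟨j, rfl⟩ := Nat.exists_eq_add_of_le hi
      rw [← shift_iterate_apply, ← shift_iterate_apply, y.2, z.2]
  refine le_trans (ENNReal.tsum_le_tsum fun y => ?_) (ENNReal.tsum_comp_le_tsum_of_injective he _)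
  have hagree : ∀ i, i < n + 1 → y.1.1 i = (e y).1.1 i := fun i hi =>
    (graft_apply (hstart y) hi).symm
  rw [hG _ _ hagree, ← mul_assoc, ← ENNReal.ofReal_mul (Real.exp_pos _).le, ← Real.exp_add]
  gcongr
  linarith [birkhoff_le_of_walters hw n hagree]

/-- The points of `[a]` for which the `j`-th return to `[a]` takes place at time `n`. -/
def returnSet (A : ℕ → ℕ → Bool) (a j n : ℕ) : Set (Space A) :=
  {y | y.1 0 = a ∧ y.1 n = a ∧ Nat.count (fun i => y.1 i = a) n = j}

theorem measurable_count (a n : ℕ) :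
    Measurable fun y : Space A => Nat.count (fun i => y.1 i = a) n := by
  induction n with
  | zero => simp
  | succ n ih =>
    simp_rw [Nat.count_succ]
    exact ih.add (Measurable.ite ((measurable_coord n) (measurableSet_singleton a))
      measurable_const measurable_const)

theorem measurableSet_returnSet (a j n : ℕ) : MeasurableSet (returnSet A a j n) :=
  ((measurable_coord 0) (measurableSet_singleton a)).inter
    (((measurable_coord n) (measurableSet_singleton a)).inter
      ((measurable_count a n) (measurableSet_singleton j)))

theorem mem_returnSet_congr {a j n : ℕ} {y z : Space A}
    (hyz : ∀ i, i < n + 1 → y.1 i = z.1 i) (hy : y ∈ returnSet A a j n) :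
    z ∈ returnSet A a j n := by
  obtain ⟨h0, hn, hc⟩ := hy
  refine ⟨(hyz 0 (by omega)) ▸ h0, (hyz n (by omega)) ▸ hn, ?_⟩
  rw [← hc, Nat.count_eq_card_filter_range, Nat.count_eq_card_filter_range]
  congr 1
  refine Finset.filter_congr fun i hi => ?_
  rw [hyz i (by have := Finset.mem_range.1 hi; omega)]

theorem notMem_returnSet_of_shift {a j n k : ℕ} (hk : 0 < k) {y : Space A}
    (hy : y ∈ returnSet A a j (k + n)) : shift^[k] y ∉ returnSet A a j n := by
  rintro ⟨-, -, hc⟩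
  obtain ⟨h0, -, hc'⟩ := hy
  simp_rw [shift_iterate_apply] at hc
  rw [Nat.count_add, hc] at hc'
  have hcz : Nat.count (fun i => y.1 i = a) k = 0 := by omega
  have := Nat.count_monotone (fun i => y.1 i = a) (show 1 ≤ k from hk)
  rw [hcz, Nat.count_succ] at this
  simp [h0] at this

theorem sum_indicator_returnSet_le (a j N : ℕ) (H : Space A → ℝ≥0∞) (z : Space A) :
    ∑ n ∈ Finset.range N, (returnSet A a j n).indicator 1 (shift^[N - n] z) * H z ≤ H z := by
  have hlt : ∀ m n, m < n → n < N → shift^[N - n] z ∈ returnSet A a j n →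
      shift^[N - m] z ∉ returnSet A a j m := by
    intro m n hmn hnN hn
    have hit : shift^[N - m] z = shift^[n - m] (shift^[N - n] z) := by
      rw [← Function.iterate_add_apply]
      congr 1
      omega
    rw [hit]
    refine notMem_returnSet_of_shift (by omega) ?_
    rwa [Nat.sub_add_cancel hmn.le]
  by_cases hex : ∃ n ∈ Finset.range N, shift^[N - n] z ∈ returnSet A a j n
  · obtain ⟨n, hnN, hn⟩ := hex
    rw [Finset.sum_eq_single n]
    · simp [hn]
    · intro m hm hmn
      have hnot : shift^[N - m] z ∉ returnSet A a j m := by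
        rcases lt_or_gt_of_ne hmn with hlt' | hgt
        · exact hlt m n hlt' (Finset.mem_range.1 hnN) hn
        · exact fun hc => hlt n m hgt (Finset.mem_range.1 hm) hc hn
      simp [hnot]
    · exact fun hc => absurd hnN hc
  · push Not at hex
    rw [Finset.sum_eq_zero]
    · exact zero_le
    · intro n hn
      simp [hex n hn]

theorem tsum_fiberOp_returnSet_le (hpos : ∀ x, 0 < h x)
    (heigf : ∀ x, ruelle A φ h x = Real.exp P * h x) (a j : ℕ) (x : Space A) :
    ∑' n, fiberOp φ P n ((returnSet A a j n).indicator fun y => ENNReal.ofReal (h y)) x ≤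
      ENNReal.ofReal (h x) := by
  set H : Space A → ℝ≥0∞ := fun y => ENNReal.ofReal (h y) with hH
  refine ENNReal.tsum_le_of_sum_range_le fun N => ?_
  have hterm : ∀ n ∈ Finset.range N, fiberOp φ P n ((returnSet A a j n).indicator H) x =
      fiberOp φ P N (fun z => (returnSet A a j n).indicator 1 (shift^[N - n] z) * H z) x := by
    intro n hn
    have hnN : N - n + n = N := by
      have := Finset.mem_range.1 hn
      omega
    conv_rhs => rw [← hnN, fiberOp_add, Nat.add_sub_cancel, fiberOp_comp_mul,
      fiberOp_eigenfunction hpos heigf]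
    congr 1
    funext y
    by_cases hy : y ∈ returnSet A a j n <;> simp [hy, hH]
  rw [Finset.sum_congr rfl hterm, ← fiberOp_finset_sum]
  calc _ ≤ fiberOp φ P N H x :=
        fiberOp_mono φ P N (fun z => sum_indicator_returnSet_le a j N H z) x
    _ = H x := by rw [hH, fiberOp_eigenfunction hpos heigf]

theorem ae_infinite_visits (hcons : Conservative A ν) (a : ℕ) :
    ∀ᵐ y ∂ν, y.1 0 = a → {i | y.1 i = a}.Infinite := by
  set W : Set (Space A) := {y | y.1 0 = a ∧ ∀ i, y.1 (i + 1) ≠ a} with hW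
  have hWm : MeasurableSet W := by
    have hWeq : W = (fun y : Space A => y.1 0) ⁻¹' {a} ∩
        ⋂ i, ((fun y : Space A => y.1 (i + 1)) ⁻¹' {a})ᶜ := by
      ext y
      simp [hW]
    rw [hWeq]
    exact ((measurable_coord 0) (measurableSet_singleton a)).inter
      (MeasurableSet.iInter fun i =>
        ((measurable_coord (i + 1)) (measurableSet_singleton a)).compl)
  have hlt : ∀ i j, i < j → (shift^[i] ⁻¹' W) ∩ (shift^[j] ⁻¹' W) = ∅ := by
    intro i j hij
    refine Set.eq_empty_of_forall_notMem ?_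
    rintro y ⟨⟨-, hi⟩, ⟨hj, -⟩⟩
    refine hi (j - i - 1) ?_
    rw [shift_iterate_apply] at hj ⊢
    rw [← hj]
    exact congrArg y.1 (by omega)
  have hW0 : ν W = 0 := by
    refine hcons.2 W hWm fun i j hij => ?_
    rcases lt_or_gt_of_ne hij with h' | h'
    · rw [hlt i j h', measure_empty]
    · rw [Set.inter_comm, hlt j i h', measure_empty]
  have hpre : ∀ n, ν (shift^[n] ⁻¹' W) = 0 := by
    intro n
    induction n with
    | zero => simpa using hW0
    | succ n ih =>
      rw [Function.iterate_succ, Set.preimage_comp,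
        ← Measure.map_apply measurable_shift ((measurable_shift.iterate n) hWm)]
      exact hcons.1.1 ih
  have hae : ∀ᵐ y ∂ν, ∀ n, shift^[n] y ∉ W := by
    rw [ae_all_iff]
    intro n
    exact measure_eq_zero_iff_ae_notMem.1 (hpre n)
  filter_upwards [hae] with y hy h0 hfin
  obtain ⟨n, hn, hmax⟩ := hfin.exists_maximal ⟨0, h0⟩
  refine hy n ⟨?_, fun i hi => ?_⟩
  · rw [shift_iterate_apply]
    exact hn
  · rw [shift_iterate_apply] at hi
    have := hmax hi (by omega)
    omega

theorem ae_indicator_eq_tsum_returnSet (hcons : Conservative A ν) (a j : ℕ)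
    (F : Space A → ℝ≥0∞) :
    ∀ᵐ y ∂ν, {y : Space A | y.1 0 = a}.indicator F y =
      ∑' n, (returnSet A a j n).indicator F y := by
  filter_upwards [ae_infinite_visits hcons a] with y hy
  by_cases h0 : y.1 0 = a
  · have hinf : {i | y.1 i = a}.Infinite := hy h0
    have hmem := Nat.nth_mem_of_infinite hinf j
    have hret : y ∈ returnSet A a j (Nat.nth (fun i => y.1 i = a) j) :=
      ⟨h0, hmem, Nat.count_nth_of_infinite hinf j⟩
    rw [tsum_eq_single (Nat.nth (fun i => y.1 i = a) j), Set.indicator_of_mem hret,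
      Set.indicator_of_mem (show y ∈ {y : Space A | y.1 0 = a} from h0)]
    intro n hn
    refine Set.indicator_of_notMem (fun hc => hn ?_) _
    exact Nat.count_injective hc.2.1 hmem (hc.2.2.trans hret.2.2.symm)
  · rw [Set.indicator_of_notMem (show y ∉ {y : Space A | y.1 0 = a} from h0)]
    refine (ENNReal.tsum_eq_zero.2 fun n => Set.indicator_of_notMem (fun hc => h0 hc.1) _).symm

/-- The infimum of `h` over the cylinder of length `k` around a point. -/
noncomputable def cylInf (h : Space A → ℝ) (k : ℕ) (y : Space A) : ℝ≥0∞ :=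
  ⨅ (z : Space A) (_ : ∀ i, i < k → y.1 i = z.1 i), ENNReal.ofReal (h z)

theorem cylInf_le (h : Space A → ℝ) (k : ℕ) (y : Space A) :
    cylInf h k y ≤ ENNReal.ofReal (h y) :=
  iInf₂_le y fun _ _ => rfl

theorem cylInf_congr (h : Space A → ℝ) {k : ℕ} {y z : Space A}
    (hyz : ∀ i, i < k → y.1 i = z.1 i) : cylInf h k y = cylInf h k z := by
  apply le_antisymm
  · exact le_iInf₂ fun u hu => iInf₂_le u fun i hi => (hyz i hi).trans (hu i hi)
  · exact le_iInf₂ fun u hu => iInf₂_le u fun i hi => (hyz i hi).symm.trans (hu i hi)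

theorem cylInf_mono (h : Space A → ℝ) : Monotone (cylInf h) := fun _ _ hkl _ =>
  le_iInf₂ fun u hu => iInf₂_le u fun i hi => hu i (hi.trans_le hkl)

theorem measurable_cylInf (h : Space A → ℝ) (k : ℕ) : Measurable (cylInf h k) := by
  let π : Space A → (Fin k → ℕ) := fun y i => y.1 i
  have hπ : Measurable π := measurable_pi_lambda _ fun i => measurable_coord i
  have hfac : Function.FactorsThrough (cylInf h k) π := fun y z hyz =>
    cylInf_congr h fun i hi => congrFun hyz ⟨i, hi⟩
  have heq : cylInf h k = Function.extend π (cylInf h k) 0 ∘ π := by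
    funext y
    exact (hfac.extend_apply 0 y).symm
  rw [heq]
  exact Measurable.of_discrete.comp hπ

theorem iSup_cylInf (hcont : Continuous h) (y : Space A) :
    ⨆ k, cylInf h k y = ENNReal.ofReal (h y) := by
  refine le_antisymm (iSup_le fun k => cylInf_le h k y) ?_
  refine le_of_forall_lt fun c hc => ?_
  obtain ⟨d, hcd, hd⟩ := exists_between hc
  have hopen : IsOpen {z : Space A | d < ENNReal.ofReal (h z)} :=
    isOpen_lt continuous_const (ENNReal.continuous_ofReal.comp hcont)
  obtain ⟨U, hU, hUeq⟩ := isOpen_induced_iff.1 hopen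
  have hyU : y.1 ∈ U := by
    have : y ∈ Subtype.val ⁻¹' U := by
      rw [hUeq]
      exact hd
    exact this
  obtain ⟨I, u, hu, hsub⟩ := isOpen_pi_iff.1 hU y.1 hyU
  refine hcd.trans_le (le_iSup_of_le (I.sup id + 1) (le_iInf₂ fun z hz => ?_))
  have hzU : z ∈ Subtype.val ⁻¹' U := by
    refine hsub fun i hi => ?_
    have hi' : i ≤ I.sup id := Finset.le_sup (f := id) hi
    rw [← hz i (by omega)]
    exact (hu i hi).2
  rw [hUeq] at hzU
  exact le_of_lt hzU

theorem setLIntegral_eigenfunction_ne_top [SigmaFinite ν] (hφ : Measurable φ)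
    (hw : Walters A φ) (hcont : Continuous h)
    (hpos : ∀ x, 0 < h x) (heigf : ∀ x, ruelle A φ h x = Real.exp P * h x)
    (heigm : DualEigen A φ (Real.exp P) ν) (hcons : Conservative A ν) (a : ℕ)
    (ha : ν {y : Space A | y.1 0 = a} ≠ ⊤) :
    ∫⁻ y in {y : Space A | y.1 0 = a}, ENNReal.ofReal (h y) ∂ν ≠ ⊤ := by
  set B : Set (Space A) := {y : Space A | y.1 0 = a} with hB
  have hBm : MeasurableSet B := (measurable_coord 0) (measurableSet_singleton a)
  rcases B.eq_empty_or_nonempty with hemp | ⟨x, hx⟩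
  · simp [hemp]
  set c : ℝ≥0∞ := ENNReal.ofReal (Real.exp (waltersBound A φ 1).toReal) with hc
  have hbound : ∀ k, ∫⁻ y in B, cylInf h k y ∂ν ≤ c * ENNReal.ofReal (h x) * ν B := by
    intro k
    set F : ℕ → Space A → ℝ≥0∞ := fun n => (returnSet A a k n).indicator (cylInf h k) with hF
    have hFm : ∀ n, Measurable (F n) := fun n =>
      (measurable_cylInf h k).indicator (measurableSet_returnSet a k n)
    have hFcongr : ∀ n (y z : Space A), (∀ i, i < n + 1 → y.1 i = z.1 i) → F n y = F n z := by
      intro n y z hyz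
      by_cases hy : y ∈ returnSet A a k n
      · have hz := mem_returnSet_congr hyz hy
        have hkn : k ≤ n := hy.2.2 ▸ Nat.count_le _
        rw [hF]
        simp only [Set.indicator_of_mem hy, Set.indicator_of_mem hz]
        exact cylInf_congr h fun i hi => hyz i (by omega)
      · have hz : z ∉ returnSet A a k n := fun hz =>
          hy (mem_returnSet_congr (fun i hi => (hyz i hi).symm) hz)
        rw [hF]
        simp only [Set.indicator_of_notMem hy, Set.indicator_of_notMem hz]
    have hsupp : ∀ n (z : Space A), z ∉ B → fiberOp φ P n (F n) z = 0 := by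
      intro n z hz
      refine ENNReal.tsum_eq_zero.2 fun y => ?_
      split_ifs with hy
      · have hy' : y ∉ returnSet A a k n := by
          rintro ⟨-, hn, -⟩
          apply hz
          change z.1 0 = a
          rw [← hy, shift_iterate_apply]
          exact hn
        simp [hF, hy']
      · rfl
    calc ∫⁻ y in B, cylInf h k y ∂ν
        = ∫⁻ y, ∑' n, F n y ∂ν := by
          rw [← lintegral_indicator hBm]
          exact lintegral_congr_ae (ae_indicator_eq_tsum_returnSet hcons a k (cylInf h k))
      _ = ∑' n, ∫⁻ z, fiberOp φ P n (F n) z ∂ν := by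
          rw [lintegral_tsum fun n => (hFm n).aemeasurable]
          exact tsum_congr fun n =>
            (lintegral_fiberOp hφ hcont.measurable hpos heigf heigm n (hFm n)).symm
      _ = ∫⁻ z, ∑' n, fiberOp φ P n (F n) z ∂ν :=
          (lintegral_tsum fun n => (measurable_fiberOp P hφ n (hFm n)).aemeasurable).symm
      _ ≤ ∫⁻ z, B.indicator (fun _ => c * ENNReal.ofReal (h x)) z ∂ν := by
          refine lintegral_mono fun z => ?_
          by_cases hz : z ∈ B
          · rw [Set.indicator_of_mem hz]
            calc ∑' n, fiberOp φ P n (F n) z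
                ≤ ∑' n, c * fiberOp φ P n (F n) x := ENNReal.tsum_le_tsum fun n =>
                  fiberOp_le_of_same_start hw n (hFcongr n)
                    ((show z.1 0 = a from hz).trans (show x.1 0 = a from hx).symm)
              _ = c * ∑' n, fiberOp φ P n (F n) x := ENNReal.tsum_mul_left
              _ ≤ c * ENNReal.ofReal (h x) := by
                gcongr
                refine le_trans (ENNReal.tsum_le_tsum fun n => ?_)
                  (tsum_fiberOp_returnSet_le hpos heigf a k x)
                exact fiberOp_mono φ P n
                  (fun y => Set.indicator_le_indicator (cylInf_le h k y)) x
          · rw [Set.indicator_of_notMem hz]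
            exact (ENNReal.tsum_eq_zero.2 fun n => hsupp n z hz).le
      _ = c * ENNReal.ofReal (h x) * ν B := lintegral_indicator_const hBm _
  have hsup : ∫⁻ y in B, ENNReal.ofReal (h y) ∂ν = ⨆ k, ∫⁻ y in B, cylInf h k y ∂ν := by
    rw [← lintegral_iSup (measurable_cylInf h) (cylInf_mono h)]
    exact lintegral_congr fun y => (iSup_cylInf hcont y).symm
  rw [hsup]
  exact ne_top_of_le_ne_top
    (ENNReal.mul_ne_top (ENNReal.mul_ne_top ENNReal.ofReal_ne_top ENNReal.ofReal_ne_top) ha)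
    (iSup_le hbound)

theorem withDensity_cyl_ne_top [SigmaFinite ν] (hφ : Measurable φ) (hw : Walters A φ)
    (hcont : Continuous h) (hpos : ∀ x, 0 < h x)
    (heigf : ∀ x, ruelle A φ h x = Real.exp P * h x) (heigm : DualEigen A φ (Real.exp P) ν)
    (hcons : Conservative A ν) (hcyl : ∀ w : List ℕ, w ≠ [] → ν (cyl A w) ≠ ⊤)
    {w : List ℕ} (hw0 : 0 < w.length) :
    (ν.withDensity fun y => ENNReal.ofReal (h y)) (cyl A w) ≠ ⊤ := by
  have hsub : cyl A w ⊆ {y : Space A | y.1 0 = w.get ⟨0, hw0⟩} := fun y hy => hy ⟨0, hw0⟩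
  have hle : {y : Space A | y.1 0 = w.get ⟨0, hw0⟩} ⊆ cyl A [w.get ⟨0, hw0⟩] := by
    rintro y hy ⟨i, hi⟩
    obtain rfl : i = 0 := by simpa using hi
    exact hy
  have ha : ν {y : Space A | y.1 0 = w.get ⟨0, hw0⟩} ≠ ⊤ :=
    ne_top_of_le_ne_top (hcyl _ (by simp)) (measure_mono hle)
  have hfin := setLIntegral_eigenfunction_ne_top hφ hw hcont hpos heigf heigm hcons _ ha
  have hm : MeasurableSet {y : Space A | y.1 0 = w.get ⟨0, hw0⟩} :=
    (measurable_coord 0) (measurableSet_singleton _)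
  rw [← withDensity_apply _ hm] at hfin
  exact ne_top_of_le_ne_top hfin (measure_mono hsub)

theorem measurableSet_cyl (w : List ℕ) : MeasurableSet (cyl A w) := by
  have heq : cyl A w = ⋂ i : Fin w.length, (fun y : Space A => y.1 i) ⁻¹' {w.get i} := by
    ext y
    simp [cyl]
  rw [heq]
  exact MeasurableSet.iInter fun i => (measurable_coord i) (measurableSet_singleton _)

theorem birkhoff_normalized (φ : Space A → ℝ) (h : Space A → ℝ) (P : ℝ) (n : ℕ) (y : Space A) :
    birkhoff (fun x => φ x + Real.log (h x) - Real.log (h (shift x)) - P) n y =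
      birkhoff φ n y - n * P + Real.log (h y) - Real.log (h (shift^[n] y)) := by
  induction n with
  | zero => simp [birkhoff]
  | succ n ih =>
    simp only [birkhoff] at ih ⊢
    rw [Finset.sum_range_succ, ih, Finset.sum_range_succ, Function.iterate_succ_apply']
    push_cast
    ring

theorem ofReal_exp_birkhoff_normalized (φ : Space A → ℝ) (P : ℝ) (hpos : ∀ x, 0 < h x) (n : ℕ)
    (y : Space A) :
    ENNReal.ofReal (Real.exp
      (birkhoff (fun x => φ x + Real.log (h x) - Real.log (h (shift x)) - P) n y)) =
      (ENNReal.ofReal (h (shift^[n] y)))⁻¹ *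
        (ENNReal.ofReal (Real.exp (birkhoff φ n y - n * P)) * ENNReal.ofReal (h y)) := by
  rw [birkhoff_normalized, Real.exp_sub, Real.exp_add, Real.exp_log (hpos _),
    Real.exp_log (hpos _), div_eq_mul_inv, mul_comm,
    ENNReal.ofReal_mul (inv_nonneg.2 (hpos _).le), ENNReal.ofReal_inv_of_pos (hpos _),
    ENNReal.ofReal_mul (Real.exp_pos _).le]

theorem dlrDen_normalized (hpos : ∀ x, 0 < h x)
    (heigf : ∀ x, ruelle A φ h x = Real.exp P * h x) (n : ℕ) (x : Space A) :
    dlrDen A (fun x => φ x + Real.log (h x) - Real.log (h (shift x)) - P) n x = 1 := by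
  have hsum : ∑' y : {y : Space A // shift^[n] y = shift^[n] x}, ENNReal.ofReal (Real.exp
      (birkhoff (fun x => φ x + Real.log (h x) - Real.log (h (shift x)) - P) n y.1)) = 1 := by
    have hterm : ∀ y : {y : Space A // shift^[n] y = shift^[n] x}, ENNReal.ofReal (Real.exp
        (birkhoff (fun x => φ x + Real.log (h x) - Real.log (h (shift x)) - P) n y.1)) =
        (ENNReal.ofReal (h (shift^[n] x)))⁻¹ *
          (ENNReal.ofReal (Real.exp (birkhoff φ n y.1 - n * P)) * ENNReal.ofReal (h y.1)) := by
      intro y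
      rw [ofReal_exp_birkhoff_normalized φ P hpos, y.2]
    rw [tsum_congr hterm, ENNReal.tsum_mul_left,
      ← fiberOp_eq_tsum_subtype φ P n (fun y => ENNReal.ofReal (h y)),
      fiberOp_eigenfunction hpos heigf]
    exact ENNReal.inv_mul_cancel (ENNReal.ofReal_pos.2 (hpos _)).ne' ENNReal.ofReal_ne_top
  have hreal := congrArg ENNReal.toReal hsum
  rw [ENNReal.tsum_toReal_eq fun _ => ENNReal.ofReal_ne_top] at hreal
  simp_rw [ENNReal.toReal_ofReal (Real.exp_pos _).le] at hreal
  exact hreal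

theorem eq_concatSeq_of_mem_cyl {w : List ℕ} {z x : Space A} (hz : z ∈ cyl A w)
    (hzx : shift^[w.length] z = x) : z.1 = concatSeq w x.1 := by
  funext i
  rw [concatSeq]
  split_ifs with hi
  · exact hz ⟨i, hi⟩
  · rw [← hzx, shift_iterate_apply]
    exact congrArg z.1 (by omega)

theorem shift_concatSeq {w : List ℕ} {x y : Space A} (hy : y.1 = concatSeq w x.1) :
    shift^[w.length] y = x := by
  apply Subtype.ext
  funext i
  rw [shift_iterate_apply, hy, concatSeq, dif_neg (by omega), Nat.add_sub_cancel_left]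

theorem mem_cyl_of_eq_concatSeq {w : List ℕ} {x y : Space A} (hy : y.1 = concatSeq w x.1) :
    y ∈ cyl A w := by
  intro i
  rw [hy, concatSeq, dif_pos i.2]

theorem dlrNum_normalized (hpos : ∀ x, 0 < h x) (w : List ℕ) (x : Space A) :
    dlrNum A (fun x => φ x + Real.log (h x) - Real.log (h (shift x)) - P) w x =
      ((ENNReal.ofReal (h (shift^[w.length] x)))⁻¹ *
        fiberOp φ P w.length ((cyl A w).indicator fun y => ENNReal.ofReal (h y))
          (shift^[w.length] x)).toReal := by
  rw [dlrNum]
  split_ifs with hadm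
  · set y : Space A := ⟨concatSeq w (shift^[w.length] x).1, hadm⟩ with hy
    have hyx : shift^[w.length] y = shift^[w.length] x := shift_concatSeq rfl
    have hyc : y ∈ cyl A w := mem_cyl_of_eq_concatSeq (x := shift^[w.length] x) rfl
    have hsum : fiberOp φ P w.length ((cyl A w).indicator fun y => ENNReal.ofReal (h y))
        (shift^[w.length] x) = ENNReal.ofReal (Real.exp
          (birkhoff φ w.length y - w.length * P)) * ENNReal.ofReal (h y) := by
      rw [fiberOp, tsum_eq_single y, if_pos hyx, Set.indicator_of_mem hyc]
      intro z hzy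
      split_ifs with hz
      · rw [Set.indicator_of_notMem, mul_zero]
        exact fun hzc => hzy (Subtype.ext (eq_concatSeq_of_mem_cyl hzc hz))
      · rfl
    rw [hsum, ← hyx, ← ofReal_exp_birkhoff_normalized φ P hpos,
      ENNReal.toReal_ofReal (Real.exp_pos _).le]
  · have hsum : fiberOp φ P w.length ((cyl A w).indicator fun y => ENNReal.ofReal (h y))
        (shift^[w.length] x) = 0 := by
      refine ENNReal.tsum_eq_zero.2 fun z => ?_
      split_ifs with hz
      · rw [Set.indicator_of_notMem, mul_zero]
        exact fun hzc => hadm (eq_concatSeq_of_mem_cyl hzc hz ▸ z.2)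
      · rfl
    rw [hsum]
    simp

theorem shiftSigma_le (n : ℕ) : shiftSigma A n ≤ Subtype.instMeasurableSpace :=
  (measurable_shift.iterate n).comap_le

theorem compatible_of_invariant {μ : Measure (Space A)} [SigmaFinite μ] (n : ℕ)
    (hinv : ∀ E, MeasurableSet E → μ (shift^[n] ⁻¹' E) = μ E) :
    Compatible A μ (shiftSigma A n) := by
  refine ⟨fun k => shift^[n] ⁻¹' spanningSets μ k, fun k => ?_, fun k => ?_, ?_⟩
  · exact ⟨spanningSets μ k, measurableSet_spanningSets μ k, rfl⟩
  · rw [hinv _ (measurableSet_spanningSets μ k)]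
    exact (measure_spanningSets_lt_top μ k).ne
  · rw [← Set.preimage_iUnion, iUnion_spanningSets, Set.preimage_univ]

theorem sigmaFinite_trim_of_compatible {μ : Measure (Space A)} {m : MeasurableSpace (Space A)}
    (hc : Compatible A μ m) (hm : m ≤ Subtype.instMeasurableSpace) :
    SigmaFinite (μ.trim hm) := by
  obtain ⟨s, hs, hfin, hun⟩ := hc
  refine ⟨⟨⟨s, fun _ => trivial, fun k => ?_, hun⟩⟩⟩
  rw [trim_measurableSet_eq hm (hs k)]
  exact (hfin k).lt_top

theorem setLIntegral_kernel [SigmaFinite ν] (hφ : Measurable φ) (hm : Measurable h)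
    (hpos : ∀ x, 0 < h x) (heigf : ∀ x, ruelle A φ h x = Real.exp P * h x)
    (heigm : DualEigen A φ (Real.exp P) ν) (n : ℕ) {C T : Set (Space A)}
    (hC : MeasurableSet C) (hT : MeasurableSet T) :
    ∫⁻ x in shift^[n] ⁻¹' T, (ENNReal.ofReal (h (shift^[n] x)))⁻¹ *
        fiberOp φ P n (C.indicator fun y => ENNReal.ofReal (h y)) (shift^[n] x)
        ∂(ν.withDensity fun y => ENNReal.ofReal (h y)) =
      (ν.withDensity fun y => ENNReal.ofReal (h y)) (C ∩ shift^[n] ⁻¹' T) := by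
  set H : Space A → ℝ≥0∞ := fun y => ENNReal.ofReal (h y) with hH
  have hHm : Measurable H := hm.ennreal_ofReal
  have hσ : Measurable (shift^[n] : Space A → Space A) := measurable_shift.iterate n
  have hKm : Measurable (fiberOp φ P n (C.indicator H)) :=
    measurable_fiberOp P hφ n (hHm.indicator hC)
  have hκ : Measurable fun x => (H x)⁻¹ * fiberOp φ P n (C.indicator H) x := hHm.inv.mul hKm
  have hset : ∫⁻ x in shift^[n] ⁻¹' T, (H (shift^[n] x))⁻¹ *
      fiberOp φ P n (C.indicator H) (shift^[n] x) ∂(ν.withDensity H) =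
      ∫⁻ x, T.indicator (fun x => (H x)⁻¹ * fiberOp φ P n (C.indicator H) x) (shift^[n] x)
        ∂(ν.withDensity H) := by
    rw [← lintegral_indicator (hσ hT)]
    rfl
  have hmul : H * T.indicator (fun x => (H x)⁻¹ * fiberOp φ P n (C.indicator H) x) =
      fiberOp φ P n (fun y => T.indicator 1 (shift^[n] y) * C.indicator H y) := by
    rw [fiberOp_comp_mul]
    funext x
    by_cases hx : x ∈ T
    · simp only [Pi.mul_apply, Set.indicator_of_mem hx, Pi.one_apply, one_mul]
      rw [← mul_assoc, ENNReal.mul_inv_cancel (ENNReal.ofReal_pos.2 (hpos x)).ne'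
        ENNReal.ofReal_ne_top, one_mul]
    · simp [hx]
  have hind : (fun y => T.indicator 1 (shift^[n] y) * C.indicator H y) =
      (C ∩ shift^[n] ⁻¹' T).indicator H := by
    funext y
    by_cases hy : y ∈ C <;> by_cases hyT : shift^[n] y ∈ T <;> simp [hy, hyT]
  have hCT : MeasurableSet (C ∩ shift^[n] ⁻¹' T) := hC.inter (hσ hT)
  rw [hset, lintegral_comp_shift_iterate hφ hm hpos heigf heigm n (hκ.indicator hT),
    lintegral_withDensity_eq_lintegral_mul _ hHm (hκ.indicator hT), hmul, hind,
    lintegral_fiberOp hφ hm hpos heigf heigm n (hHm.indicator hCT), lintegral_indicator hCT,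
    withDensity_apply _ hCT]

end Fiber

theorem statement2 (A : ℕ → ℕ → Bool) (hA : NoDegenerate A) (hmix : TopMixing A)
    (φ : Space A → ℝ) (hφ : Measurable φ) (hw : Walters A φ)
    (P : ℝ) (hP : HasGurevich A φ P) (hrec : Recurrent A φ P)
    (h : Space A → ℝ) (hcont : Continuous h) (hpos : ∀ x, 0 < h x)
    (ν : Measure (Space A)) (hsf : SigmaFinite ν) (hcons : Conservative A ν)
    (hcyl : ∀ w : List ℕ, w ≠ [] → ν (cyl A w) ≠ ⊤)
    (heigf : ∀ x, ruelle A φ h x = Real.exp P * h x)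
    (heigm : DualEigen A φ (Real.exp P) ν) :
    IsDLR A (fun x => φ x + Real.log (h x) - Real.log (h (shift x)) - P)
      (ν.withDensity fun x => ENNReal.ofReal (h x)) := by
  have hm : Measurable h := hcont.measurable
  set μ : Measure (Space A) := ν.withDensity fun x => ENNReal.ofReal (h x) with hμ
  have : SigmaFinite μ := SigmaFinite.withDensity_ofReal _
  intro n hn
  have hσ : Measurable (shift^[n] : Space A → Space A) := measurable_shift.iterate n
  have hcomp : Compatible A μ (shiftSigma A n) := by
    refine compatible_of_invariant n fun E hE => ?_
    rw [← lintegral_indicator_one (hσ hE), ← lintegral_indicator_one hE]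
    exact lintegral_comp_shift_iterate hφ hm hpos heigf heigm n (measurable_one.indicator hE)
  refine ⟨hcomp, ?_⟩
  rintro w rfl
  have : SigmaFinite (μ.trim (shiftSigma_le w.length)) :=
    sigmaFinite_trim_of_compatible hcomp (shiftSigma_le w.length)
  have hC : MeasurableSet (cyl A w) := measurableSet_cyl w
  have hCfin : μ (cyl A w) ≠ ⊤ :=
    withDensity_cyl_ne_top hφ hw hcont hpos heigf heigm hcons hcyl hn
  set κ : Space A → ℝ≥0∞ := fun x => (ENNReal.ofReal (h x))⁻¹ *
    fiberOp φ P w.length ((cyl A w).indicator fun y => ENNReal.ofReal (h y)) x with hκdef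
  have hκ : Measurable κ := hm.ennreal_ofReal.inv.mul
    (measurable_fiberOp P hφ _ (hm.ennreal_ofReal.indicator hC))
  have hker : ∀ {T}, MeasurableSet T →
      ∫⁻ x in shift^[w.length] ⁻¹' T, κ (shift^[w.length] x) ∂μ =
        μ (cyl A w ∩ shift^[w.length] ⁻¹' T) := fun hT =>
    setLIntegral_kernel hφ hm hpos heigf heigm w.length hC hT
  have hfin : ∫⁻ x, κ (shift^[w.length] x) ∂μ ≠ ⊤ := by
    have huniv := hker MeasurableSet.univ
    rw [Set.preimage_univ, Measure.restrict_univ, Set.inter_univ] at huniv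
    rwa [huniv]
  have hκσ : Measurable fun x => κ (shift^[w.length] x) := hκ.comp hσ
  have hint : Integrable (fun x => (κ (shift^[w.length] x)).toReal) μ :=
    integrable_toReal_of_lintegral_ne_top hκσ.aemeasurable hfin
  have hkernel : (fun x => dlrNum A (fun x => φ x + Real.log (h x) -
      Real.log (h (shift x)) - P) w x / dlrDen A (fun x => φ x + Real.log (h x) -
      Real.log (h (shift x)) - P) w.length x) =
      fun x => (κ (shift^[w.length] x)).toReal := by
    funext x
    rw [dlrDen_normalized hpos heigf, div_one, dlrNum_normalized hpos]
  rw [hkernel]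
  symm
  refine ae_eq_condExp_of_forall_setIntegral_eq (shiftSigma_le w.length) ?_ ?_ ?_ ?_
  · exact (integrable_indicator_iff hC).2 (integrableOn_const hCfin)
  · exact fun s _ _ => hint.integrableOn
  · rintro s ⟨T, hT, rfl⟩ -
    rw [integral_toReal hκσ.aemeasurable, hker hT, integral_indicator_const _ hC,
      measureReal_restrict_apply hC, smul_eq_mul, mul_one]
    · rfl
    · exact ae_restrict_of_ae (ae_lt_top hκσ hfin)
  · have hcm : Measurable[shiftSigma A w.length] fun x => (κ (shift^[w.length] x)).toReal :=
      hκ.ennreal_toReal.comp (comap_measurable _)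
    exact hcm.stronglyMeasurable.aestronglyMeasurable

end CMS
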